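/- Let a and b be the automorphisms of the binary rooted tree {0,1}^* defined recursively by a(0w) = 1·b(w), a(1w) = 0w, b(0w) = 0·a(w), b(1w) = 1w. Then the monoid generated by a and b inside Aut({0,1}^*) is free of rank 2: the monoid homomorphism from the free monoid on two generators to Aut({0,1}^*) sending the generators to a and b is injective. In particular the group G = ⟨a, b⟩ has exponential growth. -/

import Mathlib

mutual
  /-- `a(0w) = 1·b(w)`, `a(1w) = 0w` (`false = 0`, `true = 1`). -/
  def aFun : List Bool → List Bool
    | [] => []
    | false :: w => true :: bFun w
    | true :: w => false :: w
  /-- `b(0w) = 0·a(w)`, `b(1w) = 1w`. -/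
  def bFun : List Bool → List Bool
    | [] => []
    | false :: w => false :: aFun w
    | true :: w => true :: w
end

mutual
  /-- The inverse of `aFun`. -/
  def aInv : List Bool → List Bool
    | [] => []
    | true :: w => false :: bInv w
    | false :: w => true :: w
  /-- The inverse of `bFun`. -/
  def bInv : List Bool → List Bool
    | [] => []
    | false :: w => false :: aInv w
    | true :: w => true :: w
end

lemma left_inv_ab : ∀ w : List Bool, aInv (aFun w) = w ∧ bInv (bFun w) = w := by
  intro w
  induction w with
  | nil => exact ⟨rfl, rfl⟩
  | cons x t ih =>
    cases x
    · exact ⟨by simp [aFun, aInv, ih.2], by simp [bFun, bInv, ih.1]⟩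
    · exact ⟨by simp [aFun, aInv], by simp [bFun, bInv]⟩

lemma right_inv_ab : ∀ w : List Bool, aFun (aInv w) = w ∧ bFun (bInv w) = w := by
  intro w
  induction w with
  | nil => exact ⟨rfl, rfl⟩
  | cons x t ih =>
    cases x
    · exact ⟨by simp [aFun, aInv], by simp [bFun, bInv, ih.1]⟩
    · exact ⟨by simp [aFun, aInv, ih.2], by simp [bFun, bInv]⟩

/-- The automorphism `a` of the binary rooted tree. -/
def aPerm : Equiv.Perm (List Bool) :=
  ⟨aFun, aInv, fun w => (left_inv_ab w).1, fun w => (right_inv_ab w).1⟩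

/-- The automorphism `b` of the binary rooted tree. -/
def bPerm : Equiv.Perm (List Bool) :=
  ⟨bFun, bInv, fun w => (left_inv_ab w).2, fun w => (right_inv_ab w).2⟩

/-- The generator of the monoid attached to a letter: `a` for `true`, `b` for `false`. -/
def genPerm (c : Bool) : Equiv.Perm (List Bool) := if c then aPerm else bPerm

/-- The tree automorphism represented by a positive word in `a` and `b`. -/
def evalWord (u : List Bool) : Equiv.Perm (List Bool) := (u.map genPerm).prod

/-- The image of the letter `x` under the word `u`. -/
def wordOut : List Bool → Bool → Bool
  | [], x => x
  | c :: u, x => xor c (wordOut u x)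

/-- A positive word representing the state (section) of the word `u` at the letter `x`. -/
def wordState : List Bool → Bool → List Bool
  | [], _ => []
  | c :: u, x => if wordOut u x then wordState u x else (!c) :: wordState u x

@[simp] lemma evalWord_nil : evalWord [] = 1 := rfl

lemma evalWord_cons (c : Bool) (u : List Bool) :
    evalWord (c :: u) = genPerm c * evalWord u := by
  simp [evalWord]

lemma genPerm_apply_cons (c x : Bool) (w : List Bool) :
    genPerm c (x :: w) = xor c x :: if x then w else genPerm (!c) w := by
  cases c <;> cases x <;> simp [genPerm, aPerm, bPerm, aFun, bFun]

lemma genPerm_apply_nil (c : Bool) : genPerm c [] = [] := by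
  cases c <;> simp [genPerm, aPerm, bPerm, aFun, bFun]

lemma evalWord_apply_nil (u : List Bool) : evalWord u [] = [] := by
  induction u with
  | nil => rfl
  | cons c u ih => rw [evalWord_cons, Equiv.Perm.mul_apply, ih, genPerm_apply_nil]

lemma evalWord_apply_cons (u : List Bool) (x : Bool) (w : List Bool) :
    evalWord u (x :: w) = wordOut u x :: evalWord (wordState u x) w := by
  induction u with
  | nil => rfl
  | cons c u ih =>
    rw [evalWord_cons, Equiv.Perm.mul_apply, ih, genPerm_apply_cons]
    cases h : wordOut u x <;> simp [wordOut, wordState, h, evalWord_cons]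

lemma wordOut_eq_of_evalWord_eq {u v : List Bool} (h : evalWord u = evalWord v) (x : Bool) :
    wordOut u x = wordOut v x := by
  have := DFunLike.congr_fun h [x]
  simp only [evalWord_apply_cons, List.cons.injEq] at this
  exact this.1

lemma evalWord_wordState_eq {u v : List Bool} (h : evalWord u = evalWord v) (x : Bool) :
    evalWord (wordState u x) = evalWord (wordState v x) := by
  ext1 w
  have := DFunLike.congr_fun h (x :: w)
  simp only [evalWord_apply_cons, List.cons.injEq] at this
  exact this.2

lemma wordOut_not (u : List Bool) (x : Bool) : wordOut u (!x) = !wordOut u x := by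
  induction u with
  | nil => rfl
  | cons c u ih => simp [wordOut, ih]

lemma exists_wordOut_eq_false (u : List Bool) : ∃ x, wordOut u x = false := by
  cases h : wordOut u false
  · exact ⟨_, h⟩
  · exact ⟨true, by simpa [h] using wordOut_not u false⟩

lemma length_wordState_le (u : List Bool) (x : Bool) :
    (wordState u x).length ≤ u.length := by
  induction u with
  | nil => simp [wordState]
  | cons c u ih =>
    rw [wordState]
    split <;> simp only [List.length_cons] <;> omega

/-- If `u` sends `x` to `1`, then its state at `x` is empty (only possible when `x = 1`) or
starts with `b`. -/
lemma wordState_of_wordOut_eq_true {u : List Bool} {x : Bool} (h : wordOut u x = true) :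
    (x = true ∧ wordState u x = []) ∨
      ∃ s, wordState u x = false :: s ∧ s.length < u.length := by
  induction u with
  | nil => exact .inl ⟨h, rfl⟩
  | cons c u ih =>
    cases c
    · have h' : wordOut u x = true := by simpa [wordOut] using h
      rcases ih h' with ⟨hx, hs⟩ | ⟨s, hs, hl⟩
      · exact .inl ⟨hx, by simp [wordState, h', hs]⟩
      · exact .inr ⟨s, by simp [wordState, h', hs], by simp; omega⟩
    · have h' : wordOut u x = false := by simpa [wordOut] using h
      exact .inr ⟨wordState u x, by simp [wordState, h'],
        Nat.lt_succ_of_le (length_wordState_le u x)⟩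

lemma evalWord_cons_ne_one (c : Bool) (u : List Bool) : evalWord (c :: u) ≠ 1 := by
  induction hn : u.length using Nat.strong_induction_on generalizing c u with
  | _ n ih =>
    subst hn
    have key : ∀ v : List Bool, v.length ≤ u.length → evalWord (true :: v) ≠ 1 := by
      intro v hv h
      have ho := wordOut_eq_of_evalWord_eq (v := []) h false
      have hs := evalWord_wordState_eq (v := []) h false
      have hv' : wordOut v false = true := by simpa [wordOut] using ho
      rcases wordState_of_wordOut_eq_true hv' with ⟨h0, -⟩ | ⟨s, h0, hl⟩
      · cases h0
      · simp only [wordState, hv', h0, if_true] at hs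
        exact ih _ (by omega) _ s rfl hs
    cases c
    · intro h
      have ho := wordOut_eq_of_evalWord_eq (v := []) h false
      have hs := evalWord_wordState_eq (v := []) h false
      have hu : wordOut u false = false := by simpa [wordOut] using ho
      simp only [wordState, hu] at hs
      exact key _ (length_wordState_le u false) hs
    · exact key u le_rfl

lemma evalWord_false_cons_ne_true_cons (u v : List Bool) :
    evalWord (false :: u) ≠ evalWord (true :: v) := by
  induction hn : u.length + v.length using Nat.strong_induction_on generalizing u v with
  | _ n ih =>
    subst hn
    intro h
    obtain ⟨x, hx⟩ := exists_wordOut_eq_false u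
    have ho := wordOut_eq_of_evalWord_eq h x
    have hs := evalWord_wordState_eq h x
    have hv : wordOut v x = true := by simpa [wordOut, hx] using ho
    have hl := length_wordState_le u x
    rcases wordState_of_wordOut_eq_true hv with ⟨-, h0⟩ | ⟨s, h0, hls⟩
    · simp only [wordState, hx, hv, h0, if_true] at hs
      exact evalWord_cons_ne_one _ _ hs
    · simp only [wordState, hx, hv, h0, if_true] at hs
      exact ih _ (by omega) s (wordState u x) rfl hs.symm

lemma evalWord_injective : Function.Injective evalWord := by
  intro u
  induction u with
  | nil =>
    rintro (_ | ⟨d, v⟩) h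
    · rfl
    · exact absurd h.symm (evalWord_cons_ne_one d v)
  | cons c u ih =>
    rintro (_ | ⟨d, v⟩) h
    · exact absurd h (evalWord_cons_ne_one c u)
    · obtain rfl : c = d := by
        cases c <;> cases d
        · rfl
        · exact absurd h (evalWord_false_cons_ne_true_cons u v)
        · exact absurd h.symm (evalWord_false_cons_ne_true_cons v u)
        · rfl
      rw [evalWord_cons, evalWord_cons] at h
      rw [ih (mul_left_cancel h)]

/-- Balls with respect to a finite set of elements of a monoid are finite. -/
lemma finite_setOf_prod_of_length_le {M : Type*} [Monoid M] {S : Set M} (hS : S.Finite) (n : ℕ) :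
    {g : M | ∃ l : List M, l.length ≤ n ∧ (∀ z ∈ l, z ∈ S) ∧ l.prod = g}.Finite := by
  have := hS.to_subtype
  refine ((List.finite_length_le S n).image fun l => (l.map Subtype.val).prod).subset ?_
  rintro g ⟨l, hl, hz, rfl⟩
  lift l to List S using hz
  exact ⟨l, by simpa using hl, rfl⟩

/-- The monoid generated by `a` and `b` inside `Aut({0,1}^*)` is free of rank 2:
the monoid homomorphism from the free monoid on two generators sending them to
`a` and `b` is injective.  In particular `G = ⟨a, b⟩` has exponential growth:
the ball of radius `n` with respect to the generating set `{a, b, a⁻¹, b⁻¹}`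
contains at least `2ⁿ` elements. -/
theorem statement13 :
    Function.Injective
      ⇑(FreeMonoid.lift fun i : Bool => if i then aPerm else bPerm) ∧
    ∀ n : ℕ, 2 ^ n ≤ Set.ncard {g : Equiv.Perm (List Bool) |
      ∃ l : List (Equiv.Perm (List Bool)), l.length ≤ n ∧
        (∀ z ∈ l, z ∈ ({aPerm, bPerm, aPerm⁻¹, bPerm⁻¹} :
          Set (Equiv.Perm (List Bool)))) ∧
        l.prod = g} := by
  refine ⟨fun u v h => evalWord_injective ?_, fun n => ?_⟩
  · rw [FreeMonoid.lift_apply, FreeMonoid.lift_apply] at h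
    exact h
  · have hinj : Function.Injective fun f : Fin n → Bool => evalWord (List.ofFn f) :=
      evalWord_injective.comp List.ofFn_injective
    have hcard : (Set.range fun f : Fin n → Bool => evalWord (List.ofFn f)).ncard = 2 ^ n := by
      rw [← Set.image_univ, Set.ncard_image_of_injective _ hinj, Set.ncard_univ]
      simp
    rw [← hcard]
    refine Set.ncard_le_ncard ?_ (finite_setOf_prod_of_length_le (Set.toFinite _) n)
    rintro _ ⟨f, rfl⟩
    refine ⟨(List.ofFn f).map genPerm, by simp, ?_, rfl⟩
    intro z hz
    obtain ⟨c, -, rfl⟩ := List.mem_map.1 hz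
    cases c <;> simp [genPerm]
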